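/- Convergence of infinite-dimensional entropic Mirror-Prox to a mixed Nash equilibrium: Suppose L > 0 satisfies ‖Gν − Gν'‖∞ ≤ L · dTV(ν, ν') for all ν, ν' ∈ M(Θ) and ‖G†μ − G†μ'‖∞ ≤ L · dTV(μ, μ') for all μ, μ' ∈ M(W). Let (μ_NE, ν_NE) be a mixed Nash equilibrium of F, let μ̃₁ ∈ M(W), ν̃₁ ∈ M(Θ) be such that D₀ = KL(μ_NE‖μ̃₁) + KL(ν_NE‖ν̃₁) is finite, and let 0 < η ≤ 2/L. Define the Mirror-Prox iterates for t = 1, …, T by μ_t = MD_η(μ̃_t, −g + Gν̃_t), ν_t = MD_η(ν̃_t, −G†μ̃_t), μ̃_{t+1} = MD_η(μ̃_t, −g + Gν_t), ν̃_{t+1} = MD_η(ν̃_t, −G†μ_t). Then the averaged measures μ̄_T = (1/T) Σ_{t=1}^T μ_t and ν̄_T = (1/T) Σ_{t=1}^T ν_t satisfy F(μ_NE, ν̄_T) − F(μ̄_T, ν_NE) ≤ D₀/(ηT); in particular |F(μ_NE, ν̄_T) − F(μ_NE, ν_NE)| ≤ D₀/(ηT) and |F(μ̄_T, ν_NE) −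 F(μ_NE, ν_NE)| ≤ D₀/(ηT). -/

import Mathlib

open MeasureTheory Real ENNReal

namespace Paper

noncomputable section

/-- Total variation distance between two measures:
`dTV(μ,μ') = sup over measurable A of |μ(A) − μ'(A)|`. -/
def tvDist {E : Type*} [MeasurableSpace E] (μ μ' : Measure E) : ℝ :=
  ⨆ A : {A : Set E // MeasurableSet A}, |(μ A.1).toReal - (μ' A.1).toReal|

/-- Essential supremum of `|h|` on `Z` with respect to Lebesgue measure. -/
def supNormOn {d : ℕ} (Z : Set (Fin d → ℝ)) (h : (Fin d → ℝ) → ℝ) : ℝ :=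
  (essSup (fun z => ENNReal.ofReal |h z|) (volume.restrict Z)).toReal

/-- `μ ∈ M(Z)`: a Borel probability measure on `Z`, absolutely continuous w.r.t.
Lebesgue measure restricted to `Z`, with (a.e. on `Z`) positive density `ρ`. -/
def IsDensityMeasure {d : ℕ} (Z : Set (Fin d → ℝ)) (μ : Measure (Fin d → ℝ))
    (ρ : (Fin d → ℝ) → ℝ) : Prop :=
  IsProbabilityMeasure μ ∧ Measurable ρ ∧
    (∀ᵐ z ∂(volume.restrict Z), 0 < ρ z) ∧
    μ = (volume.restrict Z).withDensity (fun z => ENNReal.ofReal (ρ z))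

/-- Entropic mirror-descent update `MD_η(μ, h)` for `μ` with density `ρ` on `Z`:
the probability measure with density `ρ e^{−ηh} / ∫_Z ρ e^{−ηh}`. -/
def MDmeas {d : ℕ} (Z : Set (Fin d → ℝ)) (η : ℝ) (ρ h : (Fin d → ℝ) → ℝ) :
    Measure (Fin d → ℝ) :=
  (volume.restrict Z).withDensity
    (fun z => ENNReal.ofReal
      (ρ z * Real.exp (-η * h z) / ∫ y in Z, ρ y * Real.exp (-η * h y)))

/-- Gibbs measure on `Z` with density `e^h / ∫_Z e^h` w.r.t. Lebesgue measure. -/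
def gibbsMeasure {d : ℕ} (Z : Set (Fin d → ℝ)) (h : (Fin d → ℝ) → ℝ) :
    Measure (Fin d → ℝ) :=
  (volume.restrict Z).withDensity
    (fun z => ENNReal.ofReal (Real.exp (h z) / ∫ y in Z, Real.exp (h y)))

/-- Log-partition functional `Φ*(h) = log ∫_Z e^h dz`. -/
def logPart {d : ℕ} (Z : Set (Fin d → ℝ)) (h : (Fin d → ℝ) → ℝ) : ℝ :=
  Real.log (∫ z in Z, Real.exp (h z))

/-- Dual Bregman divergence `D*(h,h') = Φ*(h) − Φ*(h') − ∫_Z (h−h') dGibbs(h')`. -/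
def dualBregman {d : ℕ} (Z : Set (Fin d → ℝ)) (h h' : (Fin d → ℝ) → ℝ) : ℝ :=
  logPart Z h - logPart Z h' - ∫ z, (h z - h' z) ∂(gibbsMeasure Z h')

/-- Payoff operator `(Gν)(w) = ∫_Θ K(w,θ) dν(θ)`. -/
def Gop {p q : ℕ} (K : (Fin p → ℝ) → (Fin q → ℝ) → ℝ) (ν : Measure (Fin q → ℝ))
    (w : Fin p → ℝ) : ℝ :=
  ∫ θ, K w θ ∂ν

/-- Adjoint payoff operator `(G†μ)(θ) = ∫_W K(w,θ) dμ(w)`. -/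
def Gadj {p q : ℕ} (K : (Fin p → ℝ) → (Fin q → ℝ) → ℝ) (μ : Measure (Fin p → ℝ))
    (θ : Fin q → ℝ) : ℝ :=
  ∫ w, K w θ ∂μ

/-- Mixed-strategy game value `F(μ,ν) = ⟨μ,g⟩ − ⟨μ,Gν⟩`. -/
def payoff {p q : ℕ} (g : (Fin p → ℝ) → ℝ) (K : (Fin p → ℝ) → (Fin q → ℝ) → ℝ)
    (μ : Measure (Fin p → ℝ)) (ν : Measure (Fin q → ℝ)) : ℝ :=
  (∫ w, g w ∂μ) - ∫ w, Gop K ν w ∂μ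

/-- A measurable function with a uniform bound on its absolute value. -/
def BoundedMeasurable {Ω : Type*} [MeasurableSpace Ω] (h : Ω → ℝ) : Prop :=
  Measurable h ∧ ∃ C, ∀ x, |h x| ≤ C

namespace BoundedMeasurable

variable {Ω : Type*} [MeasurableSpace Ω] {f h : Ω → ℝ}

lemma integrable (hh : BoundedMeasurable h) (μ : Measure Ω) [IsFiniteMeasure μ] :
    Integrable h μ := by
  obtain ⟨hm, C, hC⟩ := hh
  exact Integrable.of_bound hm.aestronglyMeasurable C (ae_of_all _ hC)

lemma exp (hh : BoundedMeasurable h) : BoundedMeasurable fun x => Real.exp (h x) := by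
  obtain ⟨hm, C, hC⟩ := hh
  refine ⟨hm.exp, Real.exp C, fun x => ?_⟩
  rw [abs_of_pos (Real.exp_pos _)]
  exact Real.exp_le_exp.2 ((le_abs_self _).trans (hC x))

lemma const_mul (hh : BoundedMeasurable h) (c : ℝ) : BoundedMeasurable fun x => c * h x := by
  obtain ⟨hm, C, hC⟩ := hh
  refine ⟨hm.const_mul c, |c| * C, fun x => ?_⟩
  rw [abs_mul]
  exact mul_le_mul_of_nonneg_left (hC x) (abs_nonneg c)

lemma add (hf : BoundedMeasurable f) (hh : BoundedMeasurable h) :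
    BoundedMeasurable fun x => f x + h x := by
  obtain ⟨hfm, C, hC⟩ := hf
  obtain ⟨hhm, D, hD⟩ := hh
  exact ⟨hfm.add hhm, C + D, fun x => (abs_add_le _ _).trans (add_le_add (hC x) (hD x))⟩

lemma neg (hh : BoundedMeasurable h) : BoundedMeasurable fun x => -h x := by
  simpa using hh.const_mul (-1)

lemma sub (hf : BoundedMeasurable f) (hh : BoundedMeasurable h) :
    BoundedMeasurable fun x => f x - h x := by
  simpa [sub_eq_add_neg] using hf.add hh.neg

end BoundedMeasurable

/-- The relative entropy of the tilted measure `Q.tilted φ` with respect to `Q`. -/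
def tiltedEntropy {Ω : Type*} [MeasurableSpace Ω] (Q : Measure Ω) (φ : Ω → ℝ) : ℝ :=
  (∫ x, φ x ∂(Q.tilted φ)) - Real.log (∫ x, Real.exp (φ x) ∂Q)

section Entropy

variable {Ω : Type*} [MeasurableSpace Ω] {φ f : Ω → ℝ}

lemma integral_le_log_integral_exp (P : Measure Ω) [IsProbabilityMeasure P]
    (hf : Integrable f P) (hexp : Integrable (fun x => Real.exp (f x)) P) :
    ∫ x, f x ∂P ≤ Real.log (∫ x, Real.exp (f x) ∂P) := by
  rw [Real.le_log_iff_exp_le (integral_exp_pos hexp)]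
  exact convexOn_exp.map_integral_le continuousOn_exp isClosed_univ (by simp) hf hexp

/-- The Donsker–Varadhan inequality for a tilted measure. -/
lemma integral_tilted_le_tiltedEntropy_add_log (Q : Measure Ω) [IsProbabilityMeasure Q]
    (hφ : BoundedMeasurable φ) (hf : BoundedMeasurable f) :
    ∫ x, f x ∂(Q.tilted φ) ≤ tiltedEntropy Q φ + Real.log (∫ x, Real.exp (f x) ∂Q) := by
  have hφi := hφ.exp.integrable Q
  have := isProbabilityMeasure_tilted hφi
  have key := integral_le_log_integral_exp (Q.tilted φ) ((hf.sub hφ).integrable _)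
    ((hf.sub hφ).exp.integrable _)
  rw [integral_sub (hf.integrable _) (hφ.integrable _), integral_exp_tilted] at key
  simp only [Pi.add_apply, add_sub_cancel] at key
  rw [Real.log_div (integral_exp_pos (hf.exp.integrable Q)).ne' (integral_exp_pos hφi).ne'] at key
  unfold tiltedEntropy
  linarith

lemma tiltedEntropy_nonneg (Q : Measure Ω) [IsProbabilityMeasure Q] (hφ : BoundedMeasurable φ) :
    0 ≤ tiltedEntropy Q φ := by
  have := integral_tilted_le_tiltedEntropy_add_log (f := fun _ => 0) Q hφ
    ⟨measurable_const, 0, by simp⟩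
  simpa using this

/-- Hoeffding's lemma in logarithmic form for an almost surely bounded function. -/
lemma log_integral_exp_mul_le (Q : Measure Ω) [IsProbabilityMeasure Q]
    (hf : BoundedMeasurable f) {c : ℝ} (hfc : ∀ᵐ x ∂Q, |f x| ≤ c) (s : ℝ) :
    Real.log (∫ x, Real.exp (s * f x) ∂Q) ≤ s * ∫ x, f x ∂Q + c ^ 2 * s ^ 2 / 2 := by
  have hH := (ProbabilityTheory.hasSubgaussianMGF_of_mem_Icc (a := -c) (b := c)
    hf.1.aemeasurable (hfc.mono fun x hx => abs_le.1 hx)).mgf_le s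
  have hsq : ((((‖c - -c‖₊ / 2) ^ 2 : NNReal)) : ℝ) = c ^ 2 := by
    simp only [NNReal.coe_pow, NNReal.coe_div, coe_nnnorm, Real.norm_eq_abs, div_pow, sq_abs]
    norm_num
    ring
  rw [hsq, ProbabilityTheory.mgf] at hH
  have hfac : (fun x => Real.exp (s * (f x - ∫ y, f y ∂Q)))
      = fun x => Real.exp (s * f x) * Real.exp (-(s * ∫ y, f y ∂Q)) := by
    ext x
    rw [← Real.exp_add]
    ring_nf
  rw [hfac, integral_mul_const] at hH
  rw [Real.log_le_iff_le_exp (integral_exp_pos ((hf.const_mul s).exp.integrable Q)), Real.exp_add]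
  calc ∫ x, Real.exp (s * f x) ∂Q
      = Real.exp (s * ∫ y, f y ∂Q)
        * ((∫ x, Real.exp (s * f x) ∂Q) * Real.exp (-(s * ∫ y, f y ∂Q))) := by
        rw [Real.exp_neg]
        field_simp
    _ ≤ _ := mul_le_mul_of_nonneg_left hH (Real.exp_pos _).le

/-- Pinsker's inequality tested against a function bounded almost surely by `c`. -/
lemma sq_integral_tilted_sub_integral_le (Q : Measure Ω) [IsProbabilityMeasure Q]
    (hφ : BoundedMeasurable φ) (hf : BoundedMeasurable f) {c : ℝ} (hfc : ∀ᵐ x ∂Q, |f x| ≤ c) :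
    ((∫ x, f x ∂(Q.tilted φ)) - ∫ x, f x ∂Q) ^ 2 ≤ 2 * c ^ 2 * tiltedEntropy Q φ := by
  have key : ∀ s : ℝ, 0 ≤ (c ^ 2 / 2) * (s * s)
      + (-((∫ x, f x ∂(Q.tilted φ)) - ∫ x, f x ∂Q)) * s + tiltedEntropy Q φ := by
    intro s
    have h₁ := integral_tilted_le_tiltedEntropy_add_log Q hφ (hf.const_mul s)
    have h₂ := log_integral_exp_mul_le Q hf hfc s
    rw [integral_const_mul] at h₁
    nlinarith
  have := discrim_le_zero key
  rw [discrim] at this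
  linarith

lemma tvDist_nonneg (μ ν : Measure Ω) : 0 ≤ tvDist μ ν :=
  Real.iSup_nonneg fun _ => abs_nonneg _

/-- Pinsker's inequality for a tilted measure. -/
lemma two_mul_sq_tvDist_tilted_le (Q : Measure Ω) [IsProbabilityMeasure Q]
    (hφ : BoundedMeasurable φ) :
    2 * tvDist (Q.tilted φ) Q ^ 2 ≤ tiltedEntropy Q φ := by
  have := isProbabilityMeasure_tilted (hφ.exp.integrable Q)
  have hE := tiltedEntropy_nonneg Q hφ
  have hle : tvDist (Q.tilted φ) Q ≤ √(tiltedEntropy Q φ / 2) := by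
    have : Nonempty {A : Set Ω // MeasurableSet A} := ⟨⟨∅, .empty⟩⟩
    refine ciSup_le fun ⟨A, hA⟩ => Real.abs_le_sqrt ?_
    have hf : BoundedMeasurable (fun x => A.indicator (fun _ => (1 : ℝ)) x - 1 / 2) :=
      ⟨(measurable_const.indicator hA).sub_const _, 1 / 2, fun x => by
        by_cases hx : x ∈ A <;> norm_num [hx, abs_le]⟩
    have hint : ∀ (P : Measure Ω) [IsProbabilityMeasure P],
        ∫ x, (A.indicator (fun _ => (1 : ℝ)) x - 1 / 2) ∂P = (P A).toReal - 1 / 2 := by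
      intro P _
      rw [integral_sub ((integrable_const _).indicator hA) (integrable_const _),
        integral_indicator_const _ hA]
      simp [Measure.real]
    have key := sq_integral_tilted_sub_integral_le Q hφ hf (c := 1 / 2) (ae_of_all _ fun x => by
        by_cases hx : x ∈ A <;> norm_num [hx, abs_le])
    rw [hint, hint] at key
    simp only
    linarith
  have := Real.sq_sqrt (by positivity : 0 ≤ tiltedEntropy Q φ / 2)
  have := pow_le_pow_left₀ (tvDist_nonneg _ _) hle 2
  linarith

/-- The three-point identity behind one Mirror-Prox step for a single player. -/
lemma mirror_prox_three_point (m u : Measure Ω) [IsProbabilityMeasure m] (η : ℝ)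
    {a b : Ω → ℝ} (ha : BoundedMeasurable a) (hb : BoundedMeasurable b) :
    η * ((∫ x, b x ∂(m.tilted fun x => -η * a x)) - ∫ x, b x ∂u)
      = -(η * (∫ x, b x ∂u) + Real.log (∫ x, Real.exp (-η * b x) ∂m))
        - η * ((∫ x, (b x - a x) ∂(m.tilted fun x => -η * b x))
            - ∫ x, (b x - a x) ∂(m.tilted fun x => -η * a x))
        - tiltedEntropy (m.tilted fun x => -η * a x) (fun x => -η * (b x - a x))
        - tiltedEntropy m (fun x => -η * a x) := by
  have hai := (ha.const_mul (-η)).exp.integrable m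
  have hbi := (hb.const_mul (-η)).exp.integrable m
  have := isProbabilityMeasure_tilted hai
  have := isProbabilityMeasure_tilted hbi
  have hsum : ((fun x => -η * a x) + fun x => -η * (b x - a x)) = fun x => -η * b x := by
    ext x
    simp only [Pi.add_apply]
    ring
  unfold tiltedEntropy
  rw [tilted_tilted hai, integral_exp_tilted, hsum,
    Real.log_div (integral_exp_pos hbi).ne' (integral_exp_pos hai).ne']
  simp only [integral_const_mul]
  rw [integral_sub (hb.integrable _) (ha.integrable _),
    integral_sub (hb.integrable _) (ha.integrable _)]
  ring

end Entropy

/-- The relative entropy on `Z` of the density `ρ` with respect to the density `ρ'`. -/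
def klOn {d : ℕ} (Z : Set (Fin d → ℝ)) (ρ ρ' : (Fin d → ℝ) → ℝ) : ℝ :=
  ∫ z in Z, ρ z * Real.log (ρ z / ρ' z)

section Density

variable {d : ℕ} {Z : Set (Fin d → ℝ)} {μ μ' u : Measure (Fin d → ℝ)}
  {ρ ρ' ρu a b f h : (Fin d → ℝ) → ℝ} {η : ℝ}

namespace IsDensityMeasure

lemma absolutelyContinuous (hμ : IsDensityMeasure Z μ ρ) : μ ≪ volume.restrict Z := by
  rw [hμ.2.2.2]
  exact withDensity_absolutelyContinuous _ _

lemma integral_eq (hμ : IsDensityMeasure Z μ ρ) (f : (Fin d → ℝ) → ℝ) :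
    ∫ z, f z ∂μ = ∫ z in Z, ρ z * f z := by
  obtain ⟨-, hm, hpos, rfl⟩ := hμ
  rw [integral_withDensity_eq_integral_toReal_smul hm.ennreal_ofReal (by simp)]
  refine integral_congr_ae ?_
  filter_upwards [hpos] with z hz
  rw [ENNReal.toReal_ofReal hz.le, smul_eq_mul]

lemma integrable_iff (hμ : IsDensityMeasure Z μ ρ) :
    Integrable f μ ↔ IntegrableOn (fun z => ρ z * f z) Z := by
  obtain ⟨-, hm, hpos, rfl⟩ := hμ
  rw [integrable_withDensity_iff_integrable_smul' hm.ennreal_ofReal (by simp)]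
  refine integrable_congr ?_
  filter_upwards [hpos] with z hz
  rw [ENNReal.toReal_ofReal hz.le, smul_eq_mul]

lemma integrableOn (hμ : IsDensityMeasure Z μ ρ) : IntegrableOn ρ Z := by
  have := hμ.1
  simpa using hμ.integrable_iff.1 (integrable_const (1 : ℝ))

lemma setIntegral_eq_one (hμ : IsDensityMeasure Z μ ρ) : ∫ z in Z, ρ z = 1 := by
  have := hμ.1
  simpa using (hμ.integral_eq fun _ => 1).symm

lemma MDmeas_eq_tilted (hμ : IsDensityMeasure Z μ ρ) (hh : Measurable h) :
    MDmeas Z η ρ h = μ.tilted fun z => -η * h z := by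
  unfold MDmeas Measure.tilted
  rw [← hμ.integral_eq fun y => Real.exp (-η * h y)]
  set I := ∫ y, Real.exp (-η * h y) ∂μ
  have hI : 0 ≤ I := integral_nonneg fun _ => (Real.exp_pos _).le
  conv_rhs => rw [hμ.2.2.2]
  rw [← withDensity_mul _ hμ.2.1.ennreal_ofReal (by fun_prop)]
  congr 1 with z
  rw [Pi.mul_apply, ← ENNReal.ofReal_mul' (by positivity), mul_div_assoc]

lemma MDmeas (hμ : IsDensityMeasure Z μ ρ) (hh : BoundedMeasurable h) (η : ℝ) :
    IsDensityMeasure Z (MDmeas Z η ρ h)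
      fun z => ρ z * Real.exp (-η * h z) / ∫ y in Z, ρ y * Real.exp (-η * h y) := by
  have := hμ.1
  have hexp := (hh.const_mul (-η)).exp.integrable μ
  refine ⟨?_, ?_, ?_, rfl⟩
  · rw [hμ.MDmeas_eq_tilted hh.1]
    exact isProbabilityMeasure_tilted hexp
  · have := hμ.2.1
    have := hh.1
    fun_prop
  · have hI := integral_exp_pos hexp
    rw [hμ.integral_eq] at hI
    filter_upwards [hμ.2.2.1] with z hz
    positivity

/-- Two densities of the same measure agree almost everywhere. -/
lemma ae_eq (hμ : IsDensityMeasure Z μ ρ) (hμ' : IsDensityMeasure Z μ ρ') :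
    ρ =ᵐ[volume.restrict Z] ρ' := by
  have heq := hμ.2.2.2.symm.trans hμ'.2.2.2
  rw [withDensity_eq_iff_of_sigmaFinite hμ.2.1.ennreal_ofReal.aemeasurable
    hμ'.2.1.ennreal_ofReal.aemeasurable] at heq
  filter_upwards [heq, hμ.2.2.1, hμ'.2.2.1] with z hz h₁ h₂
  exact (ENNReal.ofReal_eq_ofReal_iff h₁.le h₂.le).1 hz

lemma klOn_nonneg (hμ : IsDensityMeasure Z μ ρ) (hμ' : IsDensityMeasure Z μ' ρ')
    (hint : IntegrableOn (fun z => ρ z * Real.log (ρ z / ρ' z)) Z) : 0 ≤ klOn Z ρ ρ' := by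
  have hle : ∫ z in Z, (ρ z - ρ' z) ≤ klOn Z ρ ρ' := by
    refine integral_mono_ae (hμ.integrableOn.sub hμ'.integrableOn) hint ?_
    filter_upwards [hμ.2.2.1, hμ'.2.2.1] with z h₁ h₂
    have hlog := Real.one_sub_inv_le_log_of_pos (div_pos h₁ h₂)
    calc ρ z - ρ' z = ρ z * (1 - (ρ z / ρ' z)⁻¹) := by field_simp
      _ ≤ _ := mul_le_mul_of_nonneg_left hlog h₁.le
  rw [integral_sub hμ.integrableOn hμ'.integrableOn, hμ.setIntegral_eq_one,
    hμ'.setIntegral_eq_one, sub_self] at hle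
  exact hle

/-- The relative entropy of a fixed measure with respect to a mirror-descent update. -/
lemma klOn_update (hu : IsDensityMeasure Z u ρu) (hμ : IsDensityMeasure Z μ ρ)
    (hμ' : IsDensityMeasure Z μ' ρ') (hh : BoundedMeasurable h)
    (hupd : μ' = Paper.MDmeas Z η ρ h)
    (hint : IntegrableOn (fun z => ρu z * Real.log (ρu z / ρ z)) Z) :
    IntegrableOn (fun z => ρu z * Real.log (ρu z / ρ' z)) Z ∧
      klOn Z ρu ρ' = klOn Z ρu ρ
        + (η * (∫ z, h z ∂u) + Real.log (∫ z, Real.exp (-η * h z) ∂μ)) := by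
  have := hu.1
  have := hμ.1
  set I := ∫ z, Real.exp (-η * h z) ∂μ with hIdef
  have hI : 0 < I := integral_exp_pos ((hh.const_mul (-η)).exp.integrable μ)
  subst hupd
  have hae := hμ'.ae_eq (hμ.MDmeas hh η)
  rw [← hμ.integral_eq fun y => Real.exp (-η * h y)] at hae
  have hlog : (fun z => ρu z * Real.log (ρu z / ρ' z)) =ᵐ[volume.restrict Z]
      fun z => ρu z * Real.log (ρu z / ρ z) + ρu z * (η * h z + Real.log I) := by
    filter_upwards [hae, hμ.2.2.1, hu.2.2.1] with z hz h₁ h₂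
    rw [hz, ← hIdef, Real.log_div h₂.ne' (by positivity), Real.log_div (by positivity) hI.ne',
      Real.log_mul h₁.ne' (Real.exp_pos _).ne', Real.log_exp, Real.log_div h₂.ne' h₁.ne']
    ring
  have hadd : Integrable (fun z => η * h z + Real.log I) u :=
    ((hh.const_mul η).integrable u).add (integrable_const _)
  have hadd' := hu.integrable_iff.1 hadd
  refine ⟨(hint.add hadd').congr hlog.symm, ?_⟩
  unfold klOn
  rw [integral_congr_ae hlog, integral_add hint hadd',
    ← hu.integral_eq fun z => η * h z + Real.log I,
    integral_add ((hh.const_mul η).integrable u) (integrable_const _), integral_const_mul]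
  simp

/-- One Mirror-Prox step for a single player, where `a` and `b` are the payoff gradients at the
current and at the extrapolated point. -/
lemma mirror_prox_step (hu : IsDensityMeasure Z u ρu) (hμ : IsDensityMeasure Z μ ρ)
    (hμ' : IsDensityMeasure Z μ' ρ') (ha : BoundedMeasurable a) (hb : BoundedMeasurable b)
    (hupd : μ' = Paper.MDmeas Z η ρ b)
    (hint : IntegrableOn (fun z => ρu z * Real.log (ρu z / ρ z)) Z)
    {c : ℝ} (hc : ∀ᵐ z ∂(volume.restrict Z), |b z - a z| ≤ c) :
    η * ((∫ z, b z ∂(Paper.MDmeas Z η ρ a)) - ∫ z, b z ∂u)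
      ≤ klOn Z ρu ρ - klOn Z ρu ρ' + η ^ 2 * c ^ 2 / 2
        - 2 * tvDist (Paper.MDmeas Z η ρ a) μ ^ 2 := by
  have := hμ.1
  have hai := (ha.const_mul (-η)).exp.integrable μ
  have := isProbabilityMeasure_tilted hai
  rw [hμ.MDmeas_eq_tilted ha.1, mirror_prox_three_point μ u η ha hb,
    (hu.klOn_update hμ hμ' hb hupd hint).2]
  have hφ := (hb.sub ha).const_mul (-η)
  have hcx : ∀ᵐ z ∂(μ.tilted fun z => -η * a z), |b z - a z| ≤ c :=
    (tilted_absolutelyContinuous _ _).ae_le (hμ.absolutelyContinuous.ae_le hc)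
  have hdual := sq_integral_tilted_sub_integral_le _ hφ (hb.sub ha) hcx
  have hsum : ((fun x => -η * a x) + fun x => -η * (b x - a x)) = fun x => -η * b x := by
    ext x
    simp only [Pi.add_apply]
    ring
  rw [tilted_tilted hai, hsum] at hdual
  have hk := tiltedEntropy_nonneg (μ.tilted fun z => -η * a z) hφ
  have htv := two_mul_sq_tvDist_tilted_le μ (ha.const_mul (-η))
  set k := tiltedEntropy (μ.tilted fun z => -η * a z) fun z => -η * (b z - a z)
  set D := (∫ z, (b z - a z) ∂(μ.tilted fun z => -η * b z))
    - ∫ z, (b z - a z) ∂(μ.tilted fun z => -η * a z)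
  have hD : |η * D| ≤ k + η ^ 2 * c ^ 2 / 2 := by
    refine abs_le_of_sq_le_sq ?_ (by positivity)
    nlinarith [sq_nonneg (k - η ^ 2 * c ^ 2 / 2), mul_le_mul_of_nonneg_left hdual (sq_nonneg η)]
  linarith [neg_abs_le (η * D)]

end IsDensityMeasure

lemma ae_abs_le_supNormOn (hh : BoundedMeasurable h) :
    ∀ᵐ z ∂(volume.restrict Z), |h z| ≤ supNormOn Z h := by
  obtain ⟨-, C, hC⟩ := hh
  have hfin : essSup (fun z => ENNReal.ofReal |h z|) (volume.restrict Z) ≠ ⊤ :=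
    ((essSup_le_of_ae_le (ENNReal.ofReal C)
      (ae_of_all _ fun z => ENNReal.ofReal_le_ofReal (hC z))).trans_lt ENNReal.ofReal_lt_top).ne
  filter_upwards [ENNReal.ae_le_essSup (μ := volume.restrict Z) fun z => ENNReal.ofReal |h z|]
    with z hz
  exact (ENNReal.ofReal_le_iff_le_toReal hfin).1 hz

end Density

section Game

variable {p q : ℕ} {K : (Fin p → ℝ) → (Fin q → ℝ) → ℝ} {BK : ℝ} {g : (Fin p → ℝ) → ℝ}

lemma boundedMeasurable_Gop (hK : Measurable (Function.uncurry K))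
    (hKbd : ∀ w θ, |K w θ| ≤ BK) (ν : Measure (Fin q → ℝ)) [IsProbabilityMeasure ν] :
    BoundedMeasurable (Gop K ν) := by
  refine ⟨hK.stronglyMeasurable.integral_prod_right.measurable, BK, fun w => ?_⟩
  simpa [Gop] using norm_integral_le_of_norm_le_const (μ := ν) (f := fun θ => K w θ)
    (ae_of_all _ fun θ => hKbd w θ)

lemma boundedMeasurable_Gadj (hK : Measurable (Function.uncurry K))
    (hKbd : ∀ w θ, |K w θ| ≤ BK) (μ : Measure (Fin p → ℝ)) [IsProbabilityMeasure μ] :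
    BoundedMeasurable (Gadj K μ) := by
  refine ⟨hK.stronglyMeasurable.integral_prod_left.measurable, BK, fun θ => ?_⟩
  simpa [Gadj] using norm_integral_le_of_norm_le_const (μ := μ) (f := fun w => K w θ)
    (ae_of_all _ fun w => hKbd w θ)

lemma integral_Gop_eq_integral_Gadj (hK : Measurable (Function.uncurry K))
    (hKbd : ∀ w θ, |K w θ| ≤ BK) (μ : Measure (Fin p → ℝ)) [IsProbabilityMeasure μ]
    (ν : Measure (Fin q → ℝ)) [IsProbabilityMeasure ν] :
    ∫ w, Gop K ν w ∂μ = ∫ θ, Gadj K μ θ ∂ν :=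
  integral_integral_swap
    (Integrable.of_bound hK.aestronglyMeasurable BK (ae_of_all _ fun x => hKbd x.1 x.2))

lemma integral_average_measure {d : ℕ} {h : (Fin d → ℝ) → ℝ} (hh : BoundedMeasurable h)
    (m : ℕ → Measure (Fin d → ℝ)) [∀ t, IsProbabilityMeasure (m t)] (T : ℕ) :
    ∫ z, h z ∂((T : ℝ≥0∞)⁻¹ • ∑ t ∈ Finset.range T, m t)
      = (T : ℝ)⁻¹ * ∑ t ∈ Finset.range T, ∫ z, h z ∂(m t) := by
  rw [integral_smul_measure, integral_finsetSum_measure fun t _ => hh.integrable (m t)]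
  simp

lemma payoff_average_left (hK : Measurable (Function.uncurry K)) (hKbd : ∀ w θ, |K w θ| ≤ BK)
    (hg : BoundedMeasurable g) (ν : Measure (Fin q → ℝ)) [IsProbabilityMeasure ν]
    (m : ℕ → Measure (Fin p → ℝ)) [∀ t, IsProbabilityMeasure (m t)] (T : ℕ) :
    payoff g K ((T : ℝ≥0∞)⁻¹ • ∑ t ∈ Finset.range T, m t) ν
      = (T : ℝ)⁻¹ * ∑ t ∈ Finset.range T, payoff g K (m t) ν := by
  unfold payoff
  rw [integral_average_measure hg, integral_average_measure (boundedMeasurable_Gop hK hKbd ν),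
    Finset.sum_sub_distrib, mul_sub]

lemma payoff_average_right (hK : Measurable (Function.uncurry K)) (hKbd : ∀ w θ, |K w θ| ≤ BK)
    (μ : Measure (Fin p → ℝ)) [IsProbabilityMeasure μ]
    (m : ℕ → Measure (Fin q → ℝ)) [∀ t, IsProbabilityMeasure (m t)] {T : ℕ} (hT : 0 < T) :
    payoff g K μ ((T : ℝ≥0∞)⁻¹ • ∑ t ∈ Finset.range T, m t)
      = (T : ℝ)⁻¹ * ∑ t ∈ Finset.range T, payoff g K μ (m t) := by
  have hGop : ∀ w, Gop K ((T : ℝ≥0∞)⁻¹ • ∑ t ∈ Finset.range T, m t) w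
      = (T : ℝ)⁻¹ * ∑ t ∈ Finset.range T, Gop K (m t) w := fun w =>
    integral_average_measure ⟨hK.of_uncurry_left, BK, hKbd w⟩ m T
  unfold payoff
  simp_rw [hGop]
  rw [integral_const_mul,
    integral_finsetSum _ fun t _ => (boundedMeasurable_Gop hK hKbd (m t)).integrable μ,
    Finset.sum_sub_distrib, mul_sub, Finset.sum_const, Finset.card_range, nsmul_eq_mul,
    inv_mul_cancel_left₀ (by positivity)]

end Game

/-- convergence of infinite-dimensional entropic Mirror-Prox to a
mixed Nash equilibrium. -/
theorem mirror_prox_converges_to_mixed_NE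
    (p q T : ℕ) (hT : 0 < T)
    (W : Set (Fin p → ℝ)) (Θ : Set (Fin q → ℝ))
    (hW : MeasurableSet W) (hΘ : MeasurableSet Θ)
    (hW0 : volume W ≠ 0) (hWfin : volume W ≠ ⊤)
    (hΘ0 : volume Θ ≠ 0) (hΘfin : volume Θ ≠ ⊤)
    (K : (Fin p → ℝ) → (Fin q → ℝ) → ℝ) (hK : Measurable (Function.uncurry K))
    (BK : ℝ) (hKbd : ∀ w θ, |K w θ| ≤ BK)
    (g : (Fin p → ℝ) → ℝ) (hg : Measurable g) (Bg : ℝ) (hgbd : ∀ w, |g w| ≤ Bg)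
    (L : ℝ) (hL : 0 < L)
    (hL1 : ∀ ν ν' : Measure (Fin q → ℝ), (∃ σ, IsDensityMeasure Θ ν σ) →
        (∃ σ', IsDensityMeasure Θ ν' σ') →
        supNormOn W (fun w => Gop K ν w - Gop K ν' w) ≤ L * tvDist ν ν')
    (hL2 : ∀ μ μ' : Measure (Fin p → ℝ), (∃ ρ, IsDensityMeasure W μ ρ) →
        (∃ ρ', IsDensityMeasure W μ' ρ') →
        supNormOn Θ (fun θ => Gadj K μ θ - Gadj K μ' θ) ≤ L * tvDist μ μ')
    (μNE : Measure (Fin p → ℝ)) (ρNE : (Fin p → ℝ) → ℝ)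
    (hμNE : IsDensityMeasure W μNE ρNE)
    (νNE : Measure (Fin q → ℝ)) (σNE : (Fin q → ℝ) → ℝ)
    (hνNE : IsDensityMeasure Θ νNE σNE)
    (hNE1 : ∀ μ : Measure (Fin p → ℝ), (∃ ρ, IsDensityMeasure W μ ρ) →
        payoff g K μ νNE ≤ payoff g K μNE νNE)
    (hNE2 : ∀ ν : Measure (Fin q → ℝ), (∃ σ, IsDensityMeasure Θ ν σ) →
        payoff g K μNE νNE ≤ payoff g K μNE ν)
    (μts : ℕ → Measure (Fin p → ℝ)) (ρts : ℕ → (Fin p → ℝ) → ℝ)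
    (hμts : ∀ t, IsDensityMeasure W (μts t) (ρts t))
    (νts : ℕ → Measure (Fin q → ℝ)) (σts : ℕ → (Fin q → ℝ) → ℝ)
    (hνts : ∀ t, IsDensityMeasure Θ (νts t) (σts t))
    (hKL1 : IntegrableOn (fun w => ρNE w * Real.log (ρNE w / ρts 0 w)) W)
    (hKL2 : IntegrableOn (fun θ => σNE θ * Real.log (σNE θ / σts 0 θ)) Θ)
    (D₀ : ℝ)
    (hD₀ : D₀ = (∫ w in W, ρNE w * Real.log (ρNE w / ρts 0 w))
        + ∫ θ in Θ, σNE θ * Real.log (σNE θ / σts 0 θ))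
    (η : ℝ) (hη : 0 < η) (hηL : η ≤ 2 / L)
    (μmid : ℕ → Measure (Fin p → ℝ))
    (hμmid : ∀ t, μmid t = MDmeas W η (ρts t) (fun w => -(g w) + Gop K (νts t) w))
    (νmid : ℕ → Measure (Fin q → ℝ))
    (hνmid : ∀ t, νmid t = MDmeas Θ η (σts t) (fun θ => -(Gadj K (μts t) θ)))
    (hrec1 : ∀ t, t < T →
        μts (t + 1) = MDmeas W η (ρts t) (fun w => -(g w) + Gop K (νmid t) w))
    (hrec2 : ∀ t, t < T →
        νts (t + 1) = MDmeas Θ η (σts t) (fun θ => -(Gadj K (μmid t) θ))) :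
    payoff g K μNE ((T : ℝ≥0∞)⁻¹ • ∑ t ∈ Finset.range T, νmid t)
        - payoff g K ((T : ℝ≥0∞)⁻¹ • ∑ t ∈ Finset.range T, μmid t) νNE
      ≤ D₀ / (η * T) ∧
    |payoff g K μNE ((T : ℝ≥0∞)⁻¹ • ∑ t ∈ Finset.range T, νmid t)
        - payoff g K μNE νNE| ≤ D₀ / (η * T) ∧
    |payoff g K ((T : ℝ≥0∞)⁻¹ • ∑ t ∈ Finset.range T, μmid t) νNE
        - payoff g K μNE νNE| ≤ D₀ / (η * T) := by
  have hgb : BoundedMeasurable g := ⟨hg, Bg, hgbd⟩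
  have := hμNE.1
  have := hνNE.1
  have := fun t => (hμts t).1
  have := fun t => (hνts t).1
  have ha₁ : ∀ t, BoundedMeasurable fun w => -(g w) + Gop K (νts t) w := fun t =>
    hgb.neg.add (boundedMeasurable_Gop hK hKbd (νts t))
  have ha₂ : ∀ t, BoundedMeasurable fun θ => -(Gadj K (μts t) θ) := fun t =>
    (boundedMeasurable_Gadj hK hKbd (μts t)).neg
  have hμd : ∀ t, ∃ ρ, IsDensityMeasure W (μmid t) ρ := fun t => by
    rw [hμmid t]
    exact ⟨_, (hμts t).MDmeas (ha₁ t) η⟩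
  have hνd : ∀ t, ∃ σ, IsDensityMeasure Θ (νmid t) σ := fun t => by
    rw [hνmid t]
    exact ⟨_, (hνts t).MDmeas (ha₂ t) η⟩
  have := fun t => (hμd t).choose_spec.1
  have := fun t => (hνd t).choose_spec.1
  have hb₁ : ∀ t, BoundedMeasurable fun w => -(g w) + Gop K (νmid t) w := fun t =>
    hgb.neg.add (boundedMeasurable_Gop hK hKbd (νmid t))
  have hb₂ : ∀ t, BoundedMeasurable fun θ => -(Gadj K (μmid t) θ) := fun t =>
    (boundedMeasurable_Gadj hK hKbd (μmid t)).neg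
  have hηL' : η ^ 2 * L ^ 2 ≤ 4 := by
    have : η * L ≤ 2 := (le_div_iff₀ hL).1 hηL
    nlinarith [mul_pos hη hL]
  have hc₁ : ∀ t, ∀ᵐ w ∂(volume.restrict W),
      |(-(g w) + Gop K (νmid t) w) - (-(g w) + Gop K (νts t) w)|
        ≤ L * tvDist (νmid t) (νts t) := by
    intro t
    filter_upwards [ae_abs_le_supNormOn (Z := W) ((boundedMeasurable_Gop hK hKbd (νmid t)).sub
      (boundedMeasurable_Gop hK hKbd (νts t)))] with w hw
    rw [add_sub_add_left_eq_sub]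
    exact hw.trans (hL1 _ _ (hνd t) ⟨_, hνts t⟩)
  have hc₂ : ∀ t, ∀ᵐ θ ∂(volume.restrict Θ),
      |-(Gadj K (μmid t) θ) - -(Gadj K (μts t) θ)| ≤ L * tvDist (μmid t) (μts t) := by
    intro t
    filter_upwards [ae_abs_le_supNormOn (Z := Θ) ((boundedMeasurable_Gadj hK hKbd (μmid t)).sub
      (boundedMeasurable_Gadj hK hKbd (μts t)))] with θ hθ
    rw [neg_sub_neg, abs_sub_comm]
    exact hθ.trans (hL2 _ _ (hμd t) ⟨_, hμts t⟩)
  have hgap : ∀ t, payoff g K μNE (νmid t) - payoff g K (μmid t) νNE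
      = ((∫ w, (-(g w) + Gop K (νmid t) w) ∂(μmid t))
          - ∫ w, (-(g w) + Gop K (νmid t) w) ∂μNE)
        + ((∫ θ, -(Gadj K (μmid t) θ) ∂(νmid t)) - ∫ θ, -(Gadj K (μmid t) θ) ∂νNE) := by
    intro t
    have hG := boundedMeasurable_Gop hK hKbd (νmid t)
    unfold payoff
    rw [integral_add (hgb.neg.integrable _) (hG.integrable _),
      integral_add (hgb.neg.integrable _) (hG.integrable _)]
    simp only [integral_neg]
    rw [← integral_Gop_eq_integral_Gadj hK hKbd, ← integral_Gop_eq_integral_Gadj hK hKbd]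
    ring
  have hsum : ∀ n ≤ T,
      IntegrableOn (fun w => ρNE w * Real.log (ρNE w / ρts n w)) W ∧
      IntegrableOn (fun θ => σNE θ * Real.log (σNE θ / σts n θ)) Θ ∧
      η * ∑ t ∈ Finset.range n, (payoff g K μNE (νmid t) - payoff g K (μmid t) νNE)
        ≤ D₀ - klOn W ρNE (ρts n) - klOn Θ σNE (σts n) := by
    intro n
    induction n with
    | zero =>
      intro _
      refine ⟨hKL1, hKL2, ?_⟩
      simp [hD₀, klOn]
    | succ n ih =>
      intro hn
      obtain ⟨hi₁, hi₂, hle⟩ := ih (by omega)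
      refine ⟨(hμNE.klOn_update (hμts n) (hμts (n + 1)) (hb₁ n) (hrec1 n hn) hi₁).1,
        (hνNE.klOn_update (hνts n) (hνts (n + 1)) (hb₂ n) (hrec2 n hn) hi₂).1, ?_⟩
      have h₁ := hμNE.mirror_prox_step (hμts n) (hμts (n + 1)) (ha₁ n) (hb₁ n) (hrec1 n hn) hi₁
        (hc₁ n)
      have h₂ := hνNE.mirror_prox_step (hνts n) (hνts (n + 1)) (ha₂ n) (hb₂ n) (hrec2 n hn) hi₂
        (hc₂ n)
      rw [← hμmid n] at h₁
      rw [← hνmid n] at h₂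
      rw [Finset.sum_range_succ, mul_add, hgap n, mul_add]
      nlinarith [mul_le_mul_of_nonneg_right hηL' (sq_nonneg (tvDist (μmid n) (μts n))),
        mul_le_mul_of_nonneg_right hηL' (sq_nonneg (tvDist (νmid n) (νts n)))]
  have hTpos : (0 : ℝ) < T := by exact_mod_cast hT
  obtain ⟨hi₁, hi₂, hle⟩ := hsum T le_rfl
  have hk₁ := hμNE.klOn_nonneg (hμts T) hi₁
  have hk₂ := hνNE.klOn_nonneg (hνts T) hi₂
  rw [payoff_average_right hK hKbd μNE νmid hT, payoff_average_left hK hKbd hgb νNE μmid T]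
  have hmain : (T : ℝ)⁻¹ * ∑ t ∈ Finset.range T, payoff g K μNE (νmid t)
      - (T : ℝ)⁻¹ * ∑ t ∈ Finset.range T, payoff g K (μmid t) νNE ≤ D₀ / (η * T) := by
    rw [← mul_sub, ← Finset.sum_sub_distrib, le_div_iff₀ (by positivity)]
    calc _ = η * ∑ t ∈ Finset.range T, (payoff g K μNE (νmid t) - payoff g K (μmid t) νNE) := by
          field_simp
      _ ≤ D₀ := by linarith
  have hlow : payoff g K μNE νNE ≤ (T : ℝ)⁻¹ * ∑ t ∈ Finset.range T, payoff g K μNE (νmid t) := by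
    rw [le_inv_mul_iff₀ hTpos]
    simpa using Finset.card_nsmul_le_sum (Finset.range T) _ _ fun t _ => hNE2 _ (hνd t)
  have hupp : (T : ℝ)⁻¹ * ∑ t ∈ Finset.range T, payoff g K (μmid t) νNE ≤ payoff g K μNE νNE := by
    rw [inv_mul_le_iff₀ hTpos]
    simpa using Finset.sum_le_card_nsmul (Finset.range T) _ _ fun t _ => hNE1 _ (hμd t)
  refine ⟨hmain, ?_, ?_⟩
  · rw [abs_of_nonneg (by linarith)]
    linarith
  · rw [abs_of_nonpos (by linarith)]
    linarith


end

end Paper
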